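/- Let φ = C_1 ∧ … ∧ C_m be a CNF formula over a non-empty variable set V and F_φ its standard translation. Then every literal argument (that is, every x and every x̄ for x ∈ V) is a stable-facet of F_φ. -/

import Mathlib

def conflictFree {α : Type*} (A : Set α) (R : Set (α × α)) (E : Set α) : Prop :=
  E ⊆ A ∧ ∀ x ∈ E, ∀ y ∈ E, (x, y) ∉ R

def defended {α : Type*} (R : Set (α × α)) (E : Set α) (x : α) : Prop :=
  ∀ y, (y, x) ∈ R → ∃ z ∈ E, (z, y) ∈ R

def admissible {α : Type*} (A : Set α) (R : Set (α × α)) (E : Set α) : Prop :=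
  conflictFree A R E ∧ ∀ x ∈ E, defended R E x

def stable {α : Type*} (A : Set α) (R : Set (α × α)) (E : Set α) : Prop :=
  conflictFree A R E ∧ ∀ x ∈ A, x ∉ E → ∃ y ∈ E, (y, x) ∈ R

def naive {α : Type*} (A : Set α) (R : Set (α × α)) (E : Set α) : Prop :=
  conflictFree A R E ∧ ∀ E', E ⊂ E' → ¬ conflictFree A R E'

def preferred {α : Type*} (A : Set α) (R : Set (α × α)) (E : Set α) : Prop :=
  admissible A R E ∧ ∀ E', E ⊂ E' → ¬ admissible A R E'

def complete {α : Type*} (A : Set α) (R : Set (α × α)) (E : Set α) : Prop :=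
  admissible A R E ∧ ∀ x ∈ A, defended R E x → x ∈ E

def credAccepted {α : Type*} (σ : Set α → Prop) (x : α) : Prop :=
  ∃ E, σ E ∧ x ∈ E

def isFacet {α : Type*} (σ : Set α → Prop) (x : α) : Prop :=
  (∃ E, σ E ∧ x ∈ E) ∧ ¬ ∀ E, σ E → x ∈ E

/-- A literal over variables `V`: a variable or its negation. -/
inductive Lit (V : Type*) where
  | pos (x : V)
  | neg (x : V)
deriving DecidableEq

/-- The complement of a literal. -/
def Lit.compl {V : Type*} : Lit V → Lit V
  | .pos x => .neg x
  | .neg x => .pos x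

/-- Evaluation of a literal under a truth assignment. -/
def Lit.eval {V : Type*} (θ : V → Bool) : Lit V → Bool
  | .pos x => θ x
  | .neg x => !θ x

/-- An assignment satisfies a clause (a finite set of literals). -/
def satClause {V : Type*} (θ : V → Bool) (c : Finset (Lit V)) : Prop :=
  ∃ ℓ ∈ c, Lit.eval θ ℓ = true

/-- An assignment satisfies a CNF with clauses `C 0, …, C (m-1)`. -/
def satCNF {V : Type*} {m : ℕ} (θ : V → Bool) (C : Fin m → Finset (Lit V)) : Prop :=
  ∀ i, satClause θ (C i)

/-- The arguments of the standard translation `F_φ`: the formula argument,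
one argument per clause, and one argument per literal. -/
inductive Arg (V : Type*) (m : ℕ) where
  | fm
  | clause (i : Fin m)
  | lit (ℓ : Lit V)

/-- The attack relation of the standard translation `F_φ`. -/
def attacksOf {V : Type*} {m : ℕ} (C : Fin m → Finset (Lit V)) :
    Set (Arg V m × Arg V m) :=
  {p | (∃ i : Fin m, p = (Arg.clause i, Arg.fm)) ∨
       (∃ ℓ : Lit V, p = (Arg.lit ℓ, Arg.lit ℓ.compl)) ∨
       (∃ i : Fin m, ∃ ℓ ∈ C i, p = (Arg.lit ℓ, Arg.clause i))}

/-- The set of literal arguments made true by the assignment `θ`. -/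
def thetaArgs {V : Type*} (m : ℕ) (θ : V → Bool) : Set (Arg V m) :=
  {x | ∃ ℓ : Lit V, Lit.eval θ ℓ = true ∧ x = Arg.lit ℓ}

def stExt {V : Type*} {m : ℕ} (C : Fin m → Finset (Lit V)) (θ : V → Bool) : Set (Arg V m) :=
  {a | match a with
    | .fm => satCNF θ C
    | .clause i => ¬ satClause θ (C i)
    | .lit l => Lit.eval θ l = true}

theorem stExt_stable {V : Type*} {m : ℕ} (C : Fin m → Finset (Lit V)) (θ : V → Bool) :
    stable Set.univ (attacksOf C) (stExt C θ) := by
  refine ⟨⟨Set.subset_univ _, ?_⟩, ?_⟩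
  · rintro x hx y hy (⟨i, h⟩ | ⟨l, h⟩ | ⟨i, l, hl, h⟩) <;> cases h
    · exact hx (hy i)
    · cases l <;> simp_all [stExt, Lit.eval, Lit.compl]
    · exact hy ⟨l, hl, hx⟩
  · rintro (_ | i | l) - hx
    · have hx' : ¬ ∀ i, satClause θ (C i) := hx
      obtain ⟨i, hi⟩ := not_forall.mp hx'
      exact ⟨.clause i, hi, Or.inl ⟨i, rfl⟩⟩
    · obtain ⟨l, hl, h⟩ : satClause θ (C i) := not_not.mp hx
      exact ⟨.lit l, h, Or.inr (Or.inr ⟨i, l, hl, rfl⟩)⟩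
    · refine ⟨.lit l.compl, ?_, Or.inr (Or.inl ⟨l.compl, ?_⟩)⟩
      · cases l <;> simp_all [stExt, Lit.eval, Lit.compl]
      · cases l <;> rfl

/-- For a CNF over a non-empty variable set, every literal argument is a
stable-facet of `F_φ`. -/
theorem literal_arg_is_stable_facet {V : Type*} [Fintype V] [DecidableEq V] [Nonempty V]
    {m : ℕ} (C : Fin m → Finset (Lit V)) :
    ∀ ℓ : Lit V, isFacet (stable Set.univ (attacksOf C)) (Arg.lit ℓ : Arg V m) := by
  intro l
  cases l with
  | pos x =>
    refine ⟨⟨_, stExt_stable C (fun _ => true), rfl⟩, fun h => ?_⟩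
    have := h _ (stExt_stable C (fun _ => false))
    simp [stExt, Lit.eval] at this
  | neg x =>
    refine ⟨⟨_, stExt_stable C (fun _ => false), rfl⟩, fun h => ?_⟩
    have := h _ (stExt_stable C (fun _ => true))
    simp [stExt, Lit.eval] at this
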